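/- arXiv:1111.0907 — 13 statements merged into one kernel-verified Lean document; each statement's English description precedes it below -/
import Mathlib

section
/- For all integers i ≥ 0 and δ ≥ 1 with i + δ ≤ n, E(i, i+δ) − E(i, i+δ−1) < n/2; and for all integers i ≥ 1 and δ ≥ 0 with i + δ ≤ n, E(i, i+δ) − E(i−1, i+δ) > n/2. -/
/-- Proposition: strict `n/2` bounds on differences of the CFHT of the (2:2)-EA with
one-bit mutation only, on the LeadingOnes problem of size `n`. -/
theorem stmt_3 (n : ℕ) (hn : 2 ≤ n) (E : ℕ → ℕ → ℝ)
    (hE1 : ∀ i, E i 0 = 0) (hE2 : ∀ j, E 0 j = 0)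
    (hrec : ∀ i j : ℕ, 1 ≤ i → i ≤ n → 1 ≤ j → j ≤ n →
      E i j = (n : ℝ) ^ 2 / (2 * n - 1)
        + ((n - 1) / (2 * (n : ℝ) - 1)) * E (i - 1) j
        + ((n - 1) / (2 * (n : ℝ) - 1)) * E i (j - 1)
        + (1 / (2 * (n : ℝ) - 1)) * E (i - 1) (j - 1)) :
    (∀ i δ : ℕ, 1 ≤ δ → i + δ ≤ n →
      E i (i + δ) - E i (i + δ - 1) < (n : ℝ) / 2) ∧
    (∀ i δ : ℕ, 1 ≤ i → i + δ ≤ n →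
      E i (i + δ) - E (i - 1) (i + δ) > (n : ℝ) / 2) := by
  have hn' : (2 : ℝ) ≤ n := by exact_mod_cast hn
  have hD : (0 : ℝ) < 2 * n - 1 := by linarith
  have R : ∀ i j : ℕ, i + 1 ≤ n → j + 1 ≤ n →
      (2 * (n : ℝ) - 1) * E (i + 1) (j + 1) = (n : ℝ) ^ 2 + (n - 1) * E i (j + 1)
        + (n - 1) * E (i + 1) j + E i j := by
    intro i j hi hj
    have h := hrec (i + 1) (j + 1) (by omega) hi (by omega) hj
    simp only [Nat.add_sub_cancel] at h
    rw [h]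
    field_simp
  have S : ∀ s i j : ℕ, i + j ≤ s → i ≤ n → j ≤ n → E i j = E j i := by
    intro s
    induction s with
    | zero =>
      intro i j h _ _
      obtain rfl : i = 0 := by omega
      obtain rfl : j = 0 := by omega
      rfl
    | succ s ih =>
      intro i j h hi hj
      rcases i with _ | i
      · rw [hE1, hE2]
      rcases j with _ | j
      · rw [hE1, hE2]
      have h1 := R i j hi hj
      have h2 := R j i hj hi
      rw [ih i (j + 1) (by omega) (by omega) hj, ih (i + 1) j (by omega) hi (by omega),
        ih i j (by omega) (by omega) (by omega)] at h1
      apply mul_left_cancel₀ hD.ne'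
      linarith
  have U : ∀ i : ℕ, (∀ j, i ≤ j → j + 1 ≤ n → E i (j + 1) - E i j < (n : ℝ) / 2) →
      ∀ j, i ≤ j → j + 1 ≤ n → (n : ℝ) / 2 < E (i + 1) (j + 1) - E i (j + 1) := by
    intro i hV j hij
    induction j, hij using Nat.le_induction with
    | base =>
      intro hi
      have h := R i i hi hi
      rw [S _ (i + 1) i le_rfl hi (by omega)] at h
      have hv := hV i le_rfl hi
      apply lt_of_mul_lt_mul_left _ hD.le
      nlinarith
    | succ j hij ih =>
      intro hj
      have h := R i (j + 1) (by omega) hj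
      have hv := hV (j + 1) (by omega) hj
      have hu := ih (by omega)
      have p1 := mul_lt_mul_of_pos_left hu (show (0 : ℝ) < n - 1 by linarith)
      have p2 := mul_lt_mul_of_pos_left hv (show (0 : ℝ) < n by linarith)
      apply lt_of_mul_lt_mul_left _ hD.le
      nlinarith
  have V : ∀ i j : ℕ, i ≤ j → j + 1 ≤ n → E i (j + 1) - E i j < (n : ℝ) / 2 := by
    intro i
    induction i with
    | zero =>
      intro j _ _
      rw [hE2, hE2]
      linarith
    | succ i ih =>
      intro j hij hj
      obtain ⟨k, rfl⟩ : ∃ k, j = k + 1 := ⟨j - 1, by omega⟩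
      have h := R i (k + 1) (by omega) hj
      have hu := U i ih k (by omega) (by omega)
      have hv := ih (k + 1) (by omega) hj
      have p1 := mul_lt_mul_of_pos_left hu (show (0 : ℝ) < n by linarith)
      have p2 := mul_lt_mul_of_pos_left hv (show (0 : ℝ) < n - 1 by linarith)
      apply lt_of_mul_lt_mul_left _ hD.le
      nlinarith
  constructor
  · intro i δ hδ h
    obtain ⟨d, rfl⟩ : ∃ d, δ = d + 1 := ⟨δ - 1, by omega⟩
    exact V i (i + d) (by omega) h
  · intro i δ hi h
    obtain ⟨k, rfl⟩ : ∃ k, i = k + 1 := ⟨i - 1, by omega⟩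
    have := U k (V k) (k + δ) (by omega) (by omega)
    rw [show k + 1 + δ = k + δ + 1 by omega]
    exact this
end

section
/- For all integers i ≥ 1 and δ ≥ 1 with i + δ ≤ n, E(i, i+δ) − E(i, i+δ−1) > n/(2^{δ+1}·(i+δ)); and for all integers i ≥ 1 and δ ≥ 0 with i + δ ≤ n, E(i, i+δ) − E(i−1, i+δ) < (1 − 3/2^{δ+3})·(n/i) + 1/2^{δ+3}. -/
theorem aux_B (n i j q A' B' B : ℝ) (hi : 1 ≤ i) (hij : i ≤ j) (hjn : j ≤ n) (hq : 0 < q)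
    (hR : ((i + j) * n - i * j) * B = n ^ 2 + i * (n - j) * B' - i * n * A')
    (hA : 8 * q * i * A' < (8 * q - 3) * n + i) (hB : n < 8 * q * j * B') :
    n < 4 * q * j * B := by
  have hD : 0 < (i + j) * n - i * j := by nlinarith
  have h1 : ((i + j) * n - i * j) * n < ((i + j) * n - i * j) * (4 * q * j * B) := by
    have e : ((i + j) * n - i * j) * (4 * q * j * B)
        = 4 * q * j * (n ^ 2 + i * (n - j) * B' - i * n * A') := by rw [← hR]; ring
    rw [e]
    have a1 : 0 < (j * n) * ((8 * q - 3) * n + i - 8 * q * i * A') :=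
      mul_pos (by nlinarith) (by linarith)
    have a2 : 0 ≤ (i * (n - j)) * (8 * q * j * B' - n) :=
      mul_nonneg (mul_nonneg (by linarith) (by linarith)) (by linarith)
    have a3 : 0 ≤ (j - i) * n * n :=
      mul_nonneg (mul_nonneg (by linarith) (by linarith)) (by linarith)
    nlinarith
  exact lt_of_mul_lt_mul_left h1 hD.le

theorem aux_B1 (n j q A' B : ℝ) (hj : 2 ≤ j) (hjn : j ≤ n) (hq : 0 < q)
    (hR : ((1 + j) * n - 1 * j) * B = n ^ 2 - n * A')
    (hA : 8 * q * A' < (8 * q - 3) * n + 1) :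
    n < 4 * q * j * B := by
  have hD : 0 < (1 + j) * n - 1 * j := by nlinarith
  have h1 : ((1 + j) * n - 1 * j) * n < ((1 + j) * n - 1 * j) * (4 * q * j * B) := by
    have e : ((1 + j) * n - 1 * j) * (4 * q * j * B)
        = 4 * q * j * (n ^ 2 - n * A') := by
      rw [← hR]; ring
    rw [e]
    have a1 : 0 < (j * n) * ((8 * q - 3) * n + 1 - 8 * q * A') :=
      mul_pos (by nlinarith) (by linarith)
    have a3 : 0 ≤ (n * j + j - 2 * n) * n := mul_nonneg (by nlinarith) (by linarith)
    nlinarith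
  exact lt_of_mul_lt_mul_left h1 hD.le

theorem aux_A (n i j p A B B' : ℝ) (hi : 1 ≤ i) (hij : i ≤ j) (hjn : j ≤ n) (hp : 0 < p)
    (hR : n ^ 2 = n * i * A + j * ((n - i) * B + i * B'))
    (hB : n < 2 * p * j * B) (hB' : n < 4 * p * j * B') :
    8 * p * i * A < (8 * p - 3) * n + i := by
  have h1 : n * (8 * p * i * A) < n * ((8 * p - 3) * n + i) := by
    have e : n * (8 * p * i * A) = 8 * p * (n ^ 2 - j * ((n - i) * B + i * B')) := by
      rw [hR]; ring
    rw [e]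
    have a1 : 0 ≤ (n - i) * (2 * p * j * B - n) := mul_nonneg (by linarith) (by linarith)
    have a2 : 0 < i * (4 * p * j * B' - n) := mul_pos (by linarith) (by linarith)
    have a3 : 0 ≤ n * (n - i) := mul_nonneg (by linarith) (by linarith)
    nlinarith
  exact lt_of_mul_lt_mul_left h1 (by linarith)

theorem aux_A0 (n i A B' : ℝ) (hi : 1 ≤ i) (hin : i ≤ n)
    (hR : n ^ 2 = n * i * A + i * ((n - i) * A + i * B'))
    (hB' : n < 4 * i * B') :
    8 * i * A < 5 * n + i := by
  have h1 : (2 * n - i) * (8 * i * A) < (2 * n - i) * (5 * n + i) := by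
    have a2 : 0 < i * (4 * i * B' - n) := mul_pos (by linarith) (by linarith)
    have a3 : 0 ≤ (2 * n + i) * (n - i) := mul_nonneg (by linarith) (by linarith)
    nlinarith
  exact lt_of_mul_lt_mul_left h1 (by linarith)

/-- case `i = 1` -/
theorem aux_A1 (n j q A A' : ℝ) (hj : 2 ≤ j) (hjn : j ≤ n) (hq : 0 < q)
    (hR : ((1 + j) * n - 1 * j) * A = n ^ 2 + (n - 1) * j * A')
    (hA : 8 * q * A' < (8 * q - 3) * n + 1) :
    16 * q * A < (16 * q - 3) * n + 1 := by
  have hD : 0 < (1 + j) * n - 1 * j := by nlinarith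
  have h1 : ((1 + j) * n - 1 * j) * (16 * q * A)
      < ((1 + j) * n - 1 * j) * ((16 * q - 3) * n + 1) := by
    have e : ((1 + j) * n - 1 * j) * (16 * q * A)
        = 16 * q * (n ^ 2 + (n - 1) * j * A') := by
      rw [← hR]; ring
    rw [e]
    have a1 : 0 < ((n - 1) * j) * ((8 * q - 3) * n + 1 - 8 * q * A') :=
      mul_pos (by nlinarith) (by linarith)
    have a3 : 0 ≤ ((n - 1) * j - n) * (3 * n - 1) := mul_nonneg (by nlinarith) (by linarith)
    nlinarith
  exact lt_of_mul_lt_mul_left h1 hD.le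

theorem aux_main (n : ℕ) (hn : 2 ≤ n) (E : ℕ → ℕ → ℝ)
    (hE1 : ∀ i, E i 0 = 0) (hE2 : ∀ j, E 0 j = 0)
    (R : ∀ i j : ℕ, i + 1 ≤ n → j + 1 ≤ n →
      (((i + 1 : ℝ) + (j + 1)) * n - (i + 1) * (j + 1)) * E (i + 1) (j + 1) = (n : ℝ) ^ 2
        + (i + 1) * (j + 1) * E i j + (i + 1) * (n - (j + 1)) * E i (j + 1)
        + (n - (i + 1)) * (j + 1) * E (i + 1) j) (i : ℕ) :
    ∀ d : ℕ, i + 1 + d ≤ n →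
      (8 * (2 : ℝ) ^ d * (i + 1) * (E (i + 1) (i + d + 1) - E i (i + d + 1))
        < (8 * 2 ^ d - 3) * n + (i + 1)) ∧
      (i + 1 + d + 1 ≤ n → (n : ℝ) < 4 * 2 ^ d * (i + d + 2) *
        (E (i + 1) (i + d + 1 + 1) - E (i + 1) (i + d + 1))) := by
  have hn' : (2 : ℝ) ≤ n := by exact_mod_cast hn
  have Dpos : ∀ i j : ℕ, i + 1 ≤ n → j + 1 ≤ n →
      0 < (((i + 1 : ℝ) + (j + 1)) * n - (i + 1) * (j + 1)) := by
    intro i j hi hj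
    have h1 : (i : ℝ) + 1 ≤ n := by exact_mod_cast hi
    have h2 : (0 : ℝ) ≤ i := by positivity
    have h3 : (0 : ℝ) ≤ j := by positivity
    nlinarith
  have sym : ∀ s i j : ℕ, i + j = s → i ≤ n → j ≤ n → E i j = E j i := by
    intro s
    induction s using Nat.strong_induction_on with
    | _ s ih =>
      intro i j hs hi hj
      rcases i with _ | i
      · rw [hE1, hE2]
      rcases j with _ | j
      · rw [hE1, hE2]
      have r1 := R i j hi hj
      have r2 := R j i hj hi
      rw [ih (i + j) (by omega) i j rfl (by omega) (by omega),
        ih (i + (j + 1)) (by omega) i (j + 1) rfl (by omega) (by omega),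
        ih (i + 1 + j) (by omega) (i + 1) j rfl (by omega) (by omega)] at r1
      refine mul_left_cancel₀ (Dpos i j hi hj).ne' ?_
      linarith
  induction i with
  | zero =>
    have key : ∀ d : ℕ, 0 + 1 + d ≤ n →
        (8 * (2 : ℝ) ^ d * E 1 (d + 1) < (8 * 2 ^ d - 3) * n + 1) := by
      intro d
      induction d with
      | zero =>
        intro _
        have r := R 0 0 (by omega) (by omega)
        simp only [hE1, hE2] at r
        norm_num at r
        norm_num
        have h1 : ((1 + 1) * (n : ℝ) - 1) * (8 * E 1 1) < ((1 + 1) * (n : ℝ) - 1) * (5 * n + 1) := by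
          nlinarith
        exact lt_of_mul_lt_mul_left h1 (by linarith)
      | succ d ih =>
        intro h
        have r := R 0 (d + 1) (by omega) (by omega)
        simp only [hE2] at r
        have hj : (d : ℝ) + 2 ≤ n := by exact_mod_cast (by omega : d + 2 ≤ n)
        have := aux_A1 n (d + 2) (2 ^ d) (E 1 (d + 2)) (E 1 (d + 1))
          (by have : (0 : ℝ) ≤ d := by positivity
              linarith) hj (by positivity)
          (by push_cast at r; simp only [zero_add] at r
              linear_combination r) (ih (by omega))
        rw [pow_succ]
        have e : d + 1 + 1 = d + 2 := rfl
        rw [e]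
        linarith
    intro d hd
    refine ⟨?_, ?_⟩
    · have := key d hd
      simp only [hE2, zero_add, Nat.cast_zero, sub_zero, mul_one]
      exact this
    · intro h
      have r := R 0 (d + 1) (by omega) (by omega)
      simp only [hE2] at r
      have hj : (d : ℝ) + 2 ≤ n := by exact_mod_cast (by omega : d + 2 ≤ n)
      have := aux_B1 n (d + 2) (2 ^ d) (E 1 (d + 1)) (E 1 (d + 2) - E 1 (d + 1))
          (by have : (0 : ℝ) ≤ d := by positivity
              linarith) hj (by positivity)
          (by push_cast at r; simp only [zero_add] at r
              linear_combination r) (key d (by omega))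
      simp only [zero_add, Nat.cast_zero]
      exact this
  | succ i ihi =>
    -- facts about the previous row
    have prev : ∀ d : ℕ, i + 1 + d + 1 ≤ n → (n : ℝ) < 4 * 2 ^ d * (i + d + 2) *
        (E (i + 1) (i + d + 1 + 1) - E (i + 1) (i + d + 1)) :=
      fun d hd => (ihi d (by omega)).2 hd
    have hi0 : (0 : ℝ) ≤ i := by positivity
    have Bst : ∀ d : ℕ, i + 2 + d + 1 ≤ n →
        (8 * (2 : ℝ) ^ d * (i + 2) * (E (i + 2) (i + d + 2) - E (i + 1) (i + d + 2))
          < (8 * 2 ^ d - 3) * n + (i + 2)) →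
        (n : ℝ) < 4 * 2 ^ d * (i + d + 3) *
          (E (i + 2) (i + d + 3) - E (i + 2) (i + d + 2)) := by
      intro d hd hA
      have r := R (i + 1) (i + d + 2) (by omega) (by omega)
      have hj : (i : ℝ) + d + 3 ≤ n := by exact_mod_cast (by omega : i + d + 3 ≤ n)
      have p := prev (d + 1) (by omega)
      have hd0 : (0 : ℝ) ≤ d := by positivity
      refine aux_B n (i + 2) (i + d + 3) (2 ^ d) _ 
        (E (i + 1) (i + d + 3) - E (i + 1) (i + d + 2)) _ (by linarith) (by linarith) hj
        (by positivity) ?_ hA ?_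
      · push_cast at r
        simp only [add_assoc] at r ⊢
        norm_num at r ⊢
        linear_combination r
      · rw [pow_succ] at p
        push_cast at p
        have e1 : i + (d + 1) + 1 + 1 = i + d + 3 := by omega
        have e2 : i + (d + 1) + 1 = i + d + 2 := by omega
        rw [e1, e2] at p
        linarith
    have key : ∀ d : ℕ, i + 2 + d ≤ n →
        (8 * (2 : ℝ) ^ d * (i + 2) * (E (i + 2) (i + d + 2) - E (i + 1) (i + d + 2))
          < (8 * 2 ^ d - 3) * n + (i + 2)) := by
      intro d
      induction d with
      | zero =>
        intro hd
        have r := R (i + 1) (i + 1) (by omega) (by omega)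
        have p := prev 0 (by omega)
        have hj : (i : ℝ) + 2 ≤ n := by exact_mod_cast (by omega : i + 2 ≤ n)
        have sy := sym _ (i + 1) (i + 2) rfl (by omega) (by omega)
        have := aux_A0 n (i + 2) (E (i + 2) (i + 2) - E (i + 1) (i + 2))
          (E (i + 1) (i + 2) - E (i + 1) (i + 1)) (by linarith) hj
          (by push_cast at r
              simp only [add_assoc] at r ⊢
              norm_num at r ⊢
              rw [← sy] at r
              linear_combination -r)
          (by norm_num at p
              linarith)
        norm_num
        linarith
      | succ d ih =>
        intro hd
        have b := Bst d (by omega) (ih (by omega))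
        have r := R (i + 1) (i + d + 2) (by omega) (by omega)
        have hj : (i : ℝ) + d + 3 ≤ n := by exact_mod_cast (by omega : i + d + 3 ≤ n)
        have p := prev (d + 1) (by omega)
        have hd0 : (0 : ℝ) ≤ d := by positivity
        have e1 : i + (d + 1) + 1 + 1 = i + d + 3 := by omega
        have e2 : i + (d + 1) + 1 = i + d + 2 := by omega
        have e3 : i + (d + 1) + 2 = i + d + 3 := by omega
        rw [e1, e2] at p
        rw [e3]
        refine aux_A n (i + 2) (i + d + 3) (2 ^ (d + 1)) _
          (E (i + 2) (i + d + 3) - E (i + 2) (i + d + 2))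
          (E (i + 1) (i + d + 3) - E (i + 1) (i + d + 2)) (by linarith) (by linarith) hj
          (by positivity) ?_ ?_ ?_
        · push_cast at r
          simp only [add_assoc] at r ⊢
          norm_num at r ⊢
          linear_combination -r
        · rw [pow_succ]
          linarith
        · push_cast at p
          linarith
    intro d hd
    have e1 : i + 1 + d + 1 = i + d + 2 := by omega
    rw [e1]
    push_cast
    have k := key d (by omega)
    refine ⟨?_, ?_⟩
    · have e2 : (i : ℝ) + 1 + 1 = i + 2 := by ring
      rw [e2]
      exact k
    · intro h
      have e2 : (i : ℝ) + 1 + d + 2 = i + d + 3 := by ring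
      rw [e2]
      exact Bst d (by omega) k

/-- Proposition: bounds on differences of the CFHT of the (2:2)-EA with
one-bit mutation only, on the OneMax problem of size `n`. -/
theorem stmt_4 (n : ℕ) (hn : 2 ≤ n) (E : ℕ → ℕ → ℝ)
    (hE1 : ∀ i, E i 0 = 0) (hE2 : ∀ j, E 0 j = 0)
    (hrec : ∀ i j : ℕ, 1 ≤ i → i ≤ n → 1 ≤ j → j ≤ n →
      E i j = (n : ℝ) ^ 2 / (((i : ℝ) + j) * n - i * j)
        + (((i : ℝ) * j) / (((i : ℝ) + j) * n - i * j)) * E (i - 1) (j - 1)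
        + (((i : ℝ) * ((n : ℝ) - j)) / (((i : ℝ) + j) * n - i * j)) * E (i - 1) j
        + ((((n : ℝ) - i) * j) / (((i : ℝ) + j) * n - i * j)) * E i (j - 1)) :
    (∀ i δ : ℕ, 1 ≤ i → 1 ≤ δ → i + δ ≤ n →
      E i (i + δ) - E i (i + δ - 1) > (n : ℝ) / (2 ^ (δ + 1) * ((i : ℝ) + δ))) ∧
    (∀ i δ : ℕ, 1 ≤ i → i + δ ≤ n →
      E i (i + δ) - E (i - 1) (i + δ) <
        (1 - 3 / 2 ^ (δ + 3)) * ((n : ℝ) / i) + 1 / 2 ^ (δ + 3)) := by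
  have R : ∀ i j : ℕ, i + 1 ≤ n → j + 1 ≤ n →
      (((i + 1 : ℝ) + (j + 1)) * n - (i + 1) * (j + 1)) * E (i + 1) (j + 1) = (n : ℝ) ^ 2
        + (i + 1) * (j + 1) * E i j + (i + 1) * (n - (j + 1)) * E i (j + 1)
        + (n - (i + 1)) * (j + 1) * E (i + 1) j := by
    intro i j hi hj
    have h := hrec (i + 1) (j + 1) (by omega) hi (by omega) hj
    have h1 : (i : ℝ) + 1 ≤ n := by exact_mod_cast hi
    have h2 : (0 : ℝ) ≤ i := by positivity
    have h3 : (0 : ℝ) ≤ j := by positivity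
    have hD : 0 < (((i + 1 : ℝ) + (j + 1)) * n - (i + 1) * (j + 1)) := by nlinarith
    push_cast at h
    rw [h]
    generalize (((i + 1 : ℝ) + (j + 1)) * n - (i + 1) * (j + 1)) = D at hD
    field_simp
  have M := aux_main n hn E hE1 hE2 R
  constructor
  · intro i δ hi hδ h
    obtain ⟨i, rfl⟩ : ∃ k, i = k + 1 := ⟨i - 1, by omega⟩
    obtain ⟨d, rfl⟩ : ∃ k, δ = k + 1 := ⟨δ - 1, by omega⟩
    have m := (M i d (by omega)).2 (by omega)
    have e1 : i + 1 + (d + 1) = i + d + 1 + 1 := by omega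
    rw [e1, Nat.add_sub_cancel, gt_iff_lt, div_lt_iff₀ (by positivity)]
    push_cast
    rw [pow_succ, pow_succ]
    linarith
  · intro i d hi h
    obtain ⟨i, rfl⟩ : ∃ k, i = k + 1 := ⟨i - 1, by omega⟩
    have m := (M i d (by omega)).1
    have e1 : i + 1 + d = i + d + 1 := by omega
    rw [e1, Nat.add_sub_cancel]
    push_cast
    have hp : (0 : ℝ) < 2 ^ d := by positivity
    have hi1 : (0 : ℝ) < i + 1 := by positivity
    have e2 : (2 : ℝ) ^ (d + 3) = 8 * 2 ^ d := by ring
    rw [e2]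
    have e3 : (1 - 3 / (8 * (2 : ℝ) ^ d)) * (n / (i + 1)) + 1 / (8 * 2 ^ d)
        = ((8 * 2 ^ d - 3) * n + (i + 1)) / (8 * 2 ^ d * (i + 1)) := by
      field_simp
    rw [e3, lt_div_iff₀ (by positivity)]
    linarith
end

section
/- For all integers i ≥ 0 and δ ≥ 1 with i + δ ≤ n, E(i, i+δ) − E(i, i+δ−1) < n/(2·(i+δ)); and for all integers i ≥ 1 and δ ≥ 0 with i + δ ≤ n, E(i, i+δ) − E(i−1, i+δ) > n/(2i). -/
/-- Proposition: bounds on differences of the CFHT of the (2:2)-EA with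
one-bit mutation only, on the OneMax problem of size `n`. -/
theorem stmt_5 (n : ℕ) (hn : 2 ≤ n) (E : ℕ → ℕ → ℝ)
    (hE1 : ∀ i, E i 0 = 0) (hE2 : ∀ j, E 0 j = 0)
    (hrec : ∀ i j : ℕ, 1 ≤ i → i ≤ n → 1 ≤ j → j ≤ n →
      E i j = (n : ℝ) ^ 2 / (((i : ℝ) + j) * n - i * j)
        + (((i : ℝ) * j) / (((i : ℝ) + j) * n - i * j)) * E (i - 1) (j - 1)
        + (((i : ℝ) * ((n : ℝ) - j)) / (((i : ℝ) + j) * n - i * j)) * E (i - 1) j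
        + ((((n : ℝ) - i) * j) / (((i : ℝ) + j) * n - i * j)) * E i (j - 1)) :
    (∀ i δ : ℕ, 1 ≤ δ → i + δ ≤ n →
      E i (i + δ) - E i (i + δ - 1) < (n : ℝ) / (2 * ((i : ℝ) + δ))) ∧
    (∀ i δ : ℕ, 1 ≤ i → i + δ ≤ n →
      E i (i + δ) - E (i - 1) (i + δ) > (n : ℝ) / (2 * (i : ℝ))) := by
  have hn0 : (0 : ℝ) < n := by exact_mod_cast (by omega : 0 < n)
  have hD : ∀ i j : ℕ, i + 1 ≤ n → j + 1 ≤ n →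
      (0 : ℝ) < (((i + 1 : ℕ) : ℝ) + (j + 1 : ℕ)) * n - (i + 1 : ℕ) * (j + 1 : ℕ) := by
    intro i j hi hj
    have h1 : ((i + 1 : ℕ) : ℝ) ≤ n := by exact_mod_cast hi
    have h2 : (0 : ℝ) < ((j + 1 : ℕ) : ℝ) := by positivity
    have h3 : (0 : ℝ) < ((i + 1 : ℕ) : ℝ) := by positivity
    nlinarith [mul_pos h3 hn0, mul_nonneg (sub_nonneg.2 h1) h2.le]
  have hR : ∀ i j : ℕ, i + 1 ≤ n → j + 1 ≤ n →
      (((i : ℝ) + 1 + (j + 1)) * n - (i + 1) * (j + 1)) * E (i + 1) (j + 1) =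
        (n : ℝ) ^ 2 + ((i : ℝ) + 1) * (j + 1) * E i j + ((i : ℝ) + 1) * (n - (j + 1)) * E i (j + 1)
          + ((n : ℝ) - (i + 1)) * (j + 1) * E (i + 1) j := by
    intro i j hi hj
    have h := hrec (i + 1) (j + 1) (by omega) hi (by omega) hj
    have hd := (hD i j hi hj).ne'
    simp only [Nat.add_sub_cancel] at h
    push_cast at h hd
    rw [h]
    field_simp
  have hS : ∀ m i j : ℕ, i + j = m → i ≤ n → j ≤ n → E i j = E j i := by
    intro m
    induction m using Nat.strong_induction_on with
    | _ m ih =>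
      intro i j hm hi hj
      rcases i with _ | i
      · rw [hE1, hE2]
      rcases j with _ | j
      · rw [hE1, hE2]
      have h1 := hR i j hi hj
      have h2 := hR j i hj hi
      have hd := hD i j hi hj
      push_cast at hd
      rw [ih (i + j) (by omega) i j rfl (by omega) (by omega),
        ih (i + (j + 1)) (by omega) i (j + 1) rfl (by omega) (by omega),
        ih (i + 1 + j) (by omega) (i + 1) j rfl (by omega) (by omega)] at h1
      apply mul_left_cancel₀ hd.ne'
      linear_combination h1 - h2
  -- bounds in product form
  have key : ∀ i : ℕ, (∀ j, i ≤ j → j + 1 ≤ n →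
        2 * ((j : ℝ) + 1) * (E i (j + 1) - E i j) < n) →
      ∀ k : ℕ, i + k + 1 ≤ n →
        (n : ℝ) < 2 * ((i : ℝ) + 1) * (E (i + 1) (i + k + 1) - E i (i + k + 1)) ∧
        (1 ≤ k → 2 * ((i + k : ℕ) + 1 : ℝ) *
          (E (i + 1) (i + k + 1) - E (i + 1) (i + k)) < n) := by
    intro i hA k
    have hi0 : (0 : ℝ) < (i : ℝ) + 1 := by positivity
    induction k with
    | zero =>
      intro hk
      refine ⟨?_, by omega⟩
      have h1 := hR i i hk hk
      have h2 := hA i le_rfl hk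
      have h3 := hS _ (i + 1) i rfl hk (by omega)
      have hin : ((i : ℝ) + 1) ≤ n := by exact_mod_cast hk
      rw [h3] at h1
      have hp : (0 : ℝ) < 2 * n - (i + 1) := by linarith
      simp only [Nat.add_zero]
      have e : (2 * (n : ℝ) - (i + 1)) * ((i + 1) * (E (i + 1) (i + 1) - E i (i + 1))) =
          n ^ 2 - (i + 1) * ((i + 1) * (E i (i + 1) - E i i)) := by linear_combination h1
      have e2 := mul_pos hi0 (sub_pos.2 h2)
      by_contra hc
      push Not at hc
      have e3 := mul_nonneg hp.le (sub_nonneg.2 hc)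
      nlinarith
    | succ k ih =>
      intro hk
      obtain ⟨hb, -⟩ := ih (by omega)
      have ha := hA (i + k + 1) (by omega) (by omega)
      have h1 := hR i (i + k + 1) (by omega) (by omega)
      have hd := hD i (i + k + 1) (by omega) (by omega)
      have hjn : (((i + k + 1 : ℕ) : ℝ) + 1) ≤ n := by exact_mod_cast hk
      have hin : ((i : ℝ) + 1) ≤ n := by exact_mod_cast (by omega : i + 1 ≤ n)
      rw [show i + (k + 1) = i + k + 1 by omega]
      rw [Nat.cast_add_one, Nat.cast_add_one (i + k + 1)] at hd
      generalize i + k + 1 = j at *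
      have hj0 : (0 : ℝ) < (j : ℝ) + 1 := by positivity
      generalize (j : ℝ) + 1 = y at *
      generalize (i : ℝ) + 1 = x at *
      have ex : (x + y) * (n : ℝ) - x * y > 0 := hd
      have eb : ((x + y) * (n : ℝ) - x * y) * (E (i + 1) (j + 1) - E i (j + 1)) =
          n ^ 2 - y * n * (E i (j + 1) - E i j) + y * (n - x) * (E (i + 1) j - E i j) := by
        linear_combination h1
      have ea : ((x + y) * (n : ℝ) - x * y) * (E (i + 1) (j + 1) - E (i + 1) j) =
          n ^ 2 - x * n * (E (i + 1) j - E i j) + x * (n - y) * (E i (j + 1) - E i j) := by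
        linear_combination h1
      generalize E (i + 1) (j + 1) - E i (j + 1) = B at *
      generalize E (i + 1) (j + 1) - E (i + 1) j = A at *
      generalize E (i + 1) j - E i j = b at *
      generalize E i (j + 1) - E i j = a at *
      constructor
      · have e1 := mul_pos (mul_pos hi0 hn0) (sub_pos.2 ha)
        have e2 := mul_nonneg (mul_nonneg hj0.le (sub_nonneg.2 hin)) (sub_pos.2 hb).le
        refine lt_of_mul_lt_mul_left ?_ ex.le
        linear_combination e1 + e2 - 2 * x * eb
      · intro _
        have e1 := mul_pos (mul_pos hj0 hn0) (sub_pos.2 hb)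
        have e2 := mul_nonneg (mul_nonneg hi0.le (sub_nonneg.2 hjn)) (sub_pos.2 ha).le
        refine lt_of_mul_lt_mul_left ?_ ex.le
        linear_combination e1 + e2 + 2 * y * ea
  have hA : ∀ i j : ℕ, i ≤ j → j + 1 ≤ n →
        2 * ((j : ℝ) + 1) * (E i (j + 1) - E i j) < n := by
    intro i
    induction i with
    | zero => intro j _ _; simpa [hE2] using hn0
    | succ i ih =>
      intro j hij hj
      obtain ⟨k, rfl⟩ := Nat.exists_eq_add_of_le hij
      have h := (key i ih (k + 1) (by omega)).2 (by omega)
      rw [show i + (k + 1) = i + 1 + k by omega] at h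
      exact h
  constructor
  · intro i δ hδ h
    obtain ⟨d, rfl⟩ := Nat.exists_eq_add_of_le' hδ
    have h1 := hA i (i + d) (by omega) (by omega)
    have hp : (0 : ℝ) < 2 * ((i : ℝ) + (d + 1 : ℕ)) := by positivity
    rw [lt_div_iff₀ hp, show i + (d + 1) - 1 = i + d by omega, ← add_assoc]
    push_cast at h1 ⊢
    linarith
  · intro i δ hi h
    obtain ⟨i, rfl⟩ := Nat.exists_eq_add_of_le' hi
    have h1 := (key i (hA i) δ (by omega)).1
    have hp : (0 : ℝ) < 2 * ((i + 1 : ℕ) : ℝ) := by positivity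
    rw [gt_iff_lt, div_lt_iff₀ hp, Nat.add_sub_cancel, show i + 1 + δ = i + δ + 1 by omega]
    push_cast
    linarith
end

section
/- For all integers i ≥ 1 and δ ≥ 0 with i + δ ≤ n, E(i, i+δ) − E(i−1, i+δ) < n/i. -/
lemma step_aux (n a b D F X : ℝ) (ha : 1 ≤ a) (hb : 1 ≤ b) (han : a ≤ n) (hbn : b ≤ n)
    (hn : 2 ≤ n) (hX : ((a + b) * n - a * b) * X = n ^ 2 + (n - a) * b * D - b * n * F)
    (hD0 : 0 ≤ D) (hD1 : D < n / a) (hF0 : 0 ≤ F) (hF1 : F < n / b)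
    (hs : 0 < F ∨ a < n) : 0 < X ∧ X < n / a := by
  have hN : 0 < (a + b) * n - a * b := by nlinarith
  rw [lt_div_iff₀ (by linarith)] at hD1 hF1
  constructor
  · have h1 : 0 ≤ (n - a) * b * D :=
      mul_nonneg (mul_nonneg (by linarith) (by linarith)) hD0
    have h2 : 0 < ((a + b) * n - a * b) * X := by
      rw [hX]; nlinarith
    exact (mul_pos_iff_of_pos_left hN).mp h2
  · rw [lt_div_iff₀ (by linarith)]
    have h3 : ((a + b) * n - a * b) * (X * a) < ((a + b) * n - a * b) * n := by
      have e : ((a + b) * n - a * b) * (X * a)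
          = (n ^ 2 + (n - a) * b * D - b * n * F) * a := by rw [← hX]; ring
      rw [e]
      have k : 0 < (n - a) * b * (n - D * a) + a * b * n * F := by
        have p1 : 0 ≤ (n - a) * b * (n - D * a) :=
          mul_nonneg (mul_nonneg (by linarith) (by linarith)) (by linarith)
        have p2 : 0 ≤ a * b * n * F := by positivity
        rcases hs with h | h
        · have : 0 < a * b * n * F := by positivity
          linarith
        · have : 0 < (n - a) * b * (n - D * a) :=
            mul_pos (mul_pos (by linarith) (by linarith)) (by linarith)
          linarith
      nlinarith
    exact lt_of_mul_lt_mul_left h3 hN.le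

/-- Proposition: for the CFHT of the (2:2)-EA with one-bit mutation only on the
OneMax problem of size `n`, `E(i, i+δ) − E(i−1, i+δ) < n/i`. -/
theorem stmt_6 (n : ℕ) (hn : 2 ≤ n) (E : ℕ → ℕ → ℝ)
    (hE1 : ∀ i, E i 0 = 0) (hE2 : ∀ j, E 0 j = 0)
    (hrec : ∀ i j : ℕ, 1 ≤ i → i ≤ n → 1 ≤ j → j ≤ n →
      E i j = (n : ℝ) ^ 2 / (((i : ℝ) + j) * n - i * j)
        + (((i : ℝ) * j) / (((i : ℝ) + j) * n - i * j)) * E (i - 1) (j - 1)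
        + (((i : ℝ) * ((n : ℝ) - j)) / (((i : ℝ) + j) * n - i * j)) * E (i - 1) j
        + ((((n : ℝ) - i) * j) / (((i : ℝ) + j) * n - i * j)) * E i (j - 1)) :
    ∀ i δ : ℕ, 1 ≤ i → i + δ ≤ n →
      E i (i + δ) - E (i - 1) (i + δ) < (n : ℝ) / i := by
  have hnR : (2 : ℝ) ≤ n := by exact_mod_cast hn
  have hrec' : ∀ i j : ℕ, i + 1 ≤ n → j + 1 ≤ n →
      ((((i + 1 : ℕ) : ℝ) + (j + 1 : ℕ)) * n - (i + 1 : ℕ) * (j + 1 : ℕ)) * E (i + 1) (j + 1)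
      = (n : ℝ) ^ 2 + ((i + 1 : ℕ) : ℝ) * (j + 1 : ℕ) * E i j
        + ((i + 1 : ℕ) : ℝ) * ((n : ℝ) - (j + 1 : ℕ)) * E i (j + 1)
        + ((n : ℝ) - (i + 1 : ℕ)) * (j + 1 : ℕ) * E (i + 1) j := by
    intro i j hi hj
    have h := hrec (i + 1) (j + 1) (by omega) hi (by omega) hj
    simp only [Nat.add_sub_cancel] at h
    have hi' : ((i + 1 : ℕ) : ℝ) ≤ n := by exact_mod_cast hi
    have hj' : ((j + 1 : ℕ) : ℝ) ≤ n := by exact_mod_cast hj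
    have hi1 : (1 : ℝ) ≤ ((i + 1 : ℕ) : ℝ) := by exact_mod_cast Nat.le_add_left 1 i
    have hj1 : (1 : ℝ) ≤ ((j + 1 : ℕ) : ℝ) := by exact_mod_cast Nat.le_add_left 1 j
    generalize ((i + 1 : ℕ) : ℝ) = a at *
    generalize ((j + 1 : ℕ) : ℝ) = b at *
    have hN : (a + b) * n - a * b ≠ 0 := by
      have : 0 < (a + b) * n - a * b := by nlinarith
      exact this.ne'
    rw [h]
    generalize (a + b) * (n : ℝ) - a * b = N at *
    field_simp
  have key : ∀ i : ℕ,
      (∀ j, i ≤ n → j + 1 ≤ n → 0 ≤ E i (j + 1) - E i j ∧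
        E i (j + 1) - E i j < (n : ℝ) / (j + 1 : ℕ) ∧ (1 ≤ i → 0 < E i (j + 1) - E i j)) ∧
      (∀ j, i + 1 ≤ n → j ≤ n → 0 ≤ E (i + 1) j - E i j ∧
        E (i + 1) j - E i j < (n : ℝ) / (i + 1 : ℕ) ∧ (1 ≤ j → 0 < E (i + 1) j - E i j)) := by
    have AofB : ∀ i : ℕ,
      (∀ j, i ≤ n → j + 1 ≤ n → 0 ≤ E i (j + 1) - E i j ∧
        E i (j + 1) - E i j < (n : ℝ) / (j + 1 : ℕ) ∧ (1 ≤ i → 0 < E i (j + 1) - E i j)) →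
      (∀ j, i + 1 ≤ n → j ≤ n → 0 ≤ E (i + 1) j - E i j ∧
        E (i + 1) j - E i j < (n : ℝ) / (i + 1 : ℕ) ∧ (1 ≤ j → 0 < E (i + 1) j - E i j)) := by
      intro i hB j hi
      induction j with
      | zero =>
        intro _
        rw [hE1, hE1]
        refine ⟨by simp, ?_, by simp⟩
        rw [sub_zero]; positivity
      | succ j ih =>
        intro hj
        obtain ⟨a0, a1, -⟩ := ih (by omega)
        obtain ⟨b0, b1, b2⟩ := hB j (by omega) hj
        have := step_aux n (i + 1 : ℕ) (j + 1 : ℕ) _ _ (E (i + 1) (j + 1) - E i (j + 1))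
          (by exact_mod_cast Nat.le_add_left 1 i) (by exact_mod_cast Nat.le_add_left 1 j)
          (by exact_mod_cast hi) (by exact_mod_cast hj) hnR
          (by rw [mul_sub, hrec' i j hi hj]; ring) a0 a1 b0 b1
          (by
            rcases Nat.eq_zero_or_pos i with h | h
            · right; subst h; exact_mod_cast (by omega : 0 + 1 < n)
            · left; exact b2 h)
        exact ⟨this.1.le, this.2, fun _ => this.1⟩
    intro i
    induction i with
    | zero =>
      have hB : (∀ j, 0 ≤ n → j + 1 ≤ n → 0 ≤ E 0 (j + 1) - E 0 j ∧
        E 0 (j + 1) - E 0 j < (n : ℝ) / (j + 1 : ℕ) ∧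
          (1 ≤ 0 → 0 < E 0 (j + 1) - E 0 j)) := by
        intro j _ _
        rw [hE2, hE2]
        refine ⟨by simp, ?_, by simp⟩
        rw [sub_zero]; positivity
      exact ⟨hB, AofB 0 hB⟩
    | succ i ih =>
      obtain ⟨hB, hA⟩ := ih
      have hB' : (∀ j, i + 1 ≤ n → j + 1 ≤ n → 0 ≤ E (i + 1) (j + 1) - E (i + 1) j ∧
        E (i + 1) (j + 1) - E (i + 1) j < (n : ℝ) / (j + 1 : ℕ) ∧
          (1 ≤ i + 1 → 0 < E (i + 1) (j + 1) - E (i + 1) j)) := by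
        intro j hi hj
        obtain ⟨a0, a1, a2⟩ := hA j hi (by omega)
        obtain ⟨b0, b1, -⟩ := hB j (by omega) hj
        have := step_aux n (j + 1 : ℕ) (i + 1 : ℕ) _ _ (E (i + 1) (j + 1) - E (i + 1) j)
          (by exact_mod_cast Nat.le_add_left 1 j) (by exact_mod_cast Nat.le_add_left 1 i)
          (by exact_mod_cast hj) (by exact_mod_cast hi) hnR
          (by
            have := hrec' i j hi hj
            linear_combination this) b0 b1 a0 a1
          (by
            rcases Nat.eq_zero_or_pos j with h | h
            · right; subst h; exact_mod_cast (by omega : 0 + 1 < n)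
            · left; exact a2 h)
        exact ⟨this.1.le, this.2, fun _ => this.1⟩
      exact ⟨hB', AofB _ hB'⟩
  intro i δ hi hd
  obtain ⟨k, rfl⟩ : ∃ k, i = k + 1 := ⟨i - 1, by omega⟩
  exact ((key k).2 (k + 1 + δ) (by omega) hd).2.1
end

section
/- For all integers 0 ≤ k ≤ n, E(1,k) = n·(1 − ((n−1)/(2n−1))^k); in particular, for all 1 ≤ k ≤ n, E(1,k) − E(1,k−1) = n²·(n−1)^{k−1}/(2n−1)^k. -/
/-- Closed form of `E(1,k)` for the CFHT of the (2:2)-EA with one-bit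
mutation only on the LeadingOnes problem of size `n`, and the resulting
formula for consecutive differences. -/
theorem stmt_7 (n : ℕ) (hn : 2 ≤ n) (E : ℕ → ℕ → ℝ)
    (hE1 : ∀ i, E i 0 = 0) (hE2 : ∀ j, E 0 j = 0)
    (hrec : ∀ i j : ℕ, 1 ≤ i → i ≤ n → 1 ≤ j → j ≤ n →
      E i j = (n : ℝ) ^ 2 / (2 * n - 1)
        + ((n - 1) / (2 * (n : ℝ) - 1)) * E (i - 1) j
        + ((n - 1) / (2 * (n : ℝ) - 1)) * E i (j - 1)
        + (1 / (2 * (n : ℝ) - 1)) * E (i - 1) (j - 1)) :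
    (∀ k : ℕ, k ≤ n →
      E 1 k = (n : ℝ) * (1 - (((n : ℝ) - 1) / (2 * (n : ℝ) - 1)) ^ k)) ∧
    (∀ k : ℕ, 1 ≤ k → k ≤ n →
      E 1 k - E 1 (k - 1)
        = (n : ℝ) ^ 2 * ((n : ℝ) - 1) ^ (k - 1) / (2 * (n : ℝ) - 1) ^ k) := by
  have hn' : (2 : ℝ) ≤ n := by exact_mod_cast hn
  have hd : (2 * (n : ℝ) - 1) ≠ 0 := by linarith
  have key : ∀ k : ℕ, k ≤ n →
      E 1 k = (n : ℝ) * (1 - (((n : ℝ) - 1) / (2 * (n : ℝ) - 1)) ^ k) := by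
    intro k
    induction k with
    | zero => intro _; simp [hE1]
    | succ k ih =>
      intro hk
      have h := hrec 1 (k + 1) le_rfl (by omega) (by omega) hk
      simp only [Nat.sub_self, Nat.add_sub_cancel, hE2, mul_zero, add_zero] at h
      rw [h, ih (by omega), pow_succ _ k]
      generalize (((n : ℝ) - 1) / (2 * (n : ℝ) - 1)) ^ k = q
      generalize hD : 2 * (n : ℝ) - 1 = d at hd
      field_simp
      rw [← hD]
      ring
  refine ⟨key, ?_⟩
  intro k hk1 hk
  obtain ⟨m, rfl⟩ : ∃ m, k = m + 1 := ⟨k - 1, by omega⟩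
  rw [Nat.add_sub_cancel, key (m + 1) hk, key m (by omega), pow_succ _ m, pow_succ _ m, div_pow]
  have hp : (2 * (n : ℝ) - 1) ^ m ≠ 0 := pow_ne_zero _ hd
  generalize hD : 2 * (n : ℝ) - 1 = d at hd hp
  field_simp
  rw [← hD]
  ring
end

section
/- For all integers 1 ≤ k ≤ n, E(1,k) < n − ((k+2)·n − (k+1)) / ((k+1)·2^{k+1}). -/
/-- Bound `E(1,k) < n − ((k+2)n − (k+1))/((k+1)·2^(k+1))` for the CFHT of the
(2:2)-EA with one-bit mutation only on the OneMax problem of size `n`. -/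
theorem stmt_8 (n : ℕ) (hn : 2 ≤ n) (E : ℕ → ℕ → ℝ)
    (hE1 : ∀ i, E i 0 = 0) (hE2 : ∀ j, E 0 j = 0)
    (hrec : ∀ i j : ℕ, 1 ≤ i → i ≤ n → 1 ≤ j → j ≤ n →
      E i j = (n : ℝ) ^ 2 / (((i : ℝ) + j) * n - i * j)
        + (((i : ℝ) * j) / (((i : ℝ) + j) * n - i * j)) * E (i - 1) (j - 1)
        + (((i : ℝ) * ((n : ℝ) - j)) / (((i : ℝ) + j) * n - i * j)) * E (i - 1) j
        + ((((n : ℝ) - i) * j) / (((i : ℝ) + j) * n - i * j)) * E i (j - 1)) :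
    ∀ k : ℕ, 1 ≤ k → k ≤ n →
      E 1 k < (n : ℝ) - (((k : ℝ) + 2) * n - ((k : ℝ) + 1)) / (((k : ℝ) + 1) * 2 ^ (k + 1)) := by
  have hn' : (2 : ℝ) ≤ n := by exact_mod_cast hn
  have key : ∀ k : ℕ, k ≤ n →
      E 1 k < (n : ℝ) - (((k : ℝ) + 2) * n - ((k : ℝ) + 1)) / (((k : ℝ) + 1) * 2 ^ (k + 1)) := by
    intro k
    induction k with
    | zero =>
      intro _
      rw [hE1]
      norm_num
      linarith
    | succ k ih =>
      intro hk
      have ih' := ih (by omega)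
      have h := hrec 1 (k + 1) le_rfl (by omega) (by omega) hk
      simp only [Nat.sub_self, Nat.add_sub_cancel, hE2, mul_zero, add_zero] at h
      push_cast at h ⊢
      have hk0 : (0 : ℝ) ≤ k := Nat.cast_nonneg k
      generalize E 1 (k + 1) = X at *
      generalize E 1 k = Y at *
      generalize (n : ℝ) = m at *
      generalize (k : ℝ) = c at *
      have hp : (0 : ℝ) < 2 ^ (k + 1) := by positivity
      rw [pow_succ 2 (k + 1)]
      generalize (2 : ℝ) ^ (k + 1) = P at *
      have hd : 0 < (c + 2) * m - (c + 1) := by nlinarith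
      have hd' : (1 + (c + 1)) * m - 1 * (c + 1) = (c + 2) * m - (c + 1) := by ring
      rw [hd'] at h
      have h1 : m - X = (m - 1) * (c + 1) / ((c + 2) * m - (c + 1)) * (m - Y) := by
        rw [h]
        generalize hD : (c + 2) * m - (c + 1) = d at *
        field_simp
        rw [← hD]
        ring
      have h2 : (m - 1) * (c + 1) / ((c + 2) * m - (c + 1))
          * (((c + 2) * m - (c + 1)) / ((c + 1) * P)) = (m - 1) / P := by
        have := hd.ne'
        have : c + 1 ≠ 0 := by positivity
        generalize (c + 2) * m - (c + 1) = d at *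
        field_simp
      have h3 : (m - 1) / P < m - X := by
        rw [h1, ← h2]
        apply mul_lt_mul_of_pos_left
        · linarith
        · apply div_pos _ hd
          apply mul_pos <;> linarith
      have h4 : ((c + 1 + 2) * m - (c + 1 + 1)) / ((c + 1 + 1) * (P * 2)) ≤ (m - 1) / P := by
        rw [div_le_div_iff₀ (by positivity) hp]
        have : (c + 1 + 2) * m - (c + 1 + 1) ≤ (m - 1) * ((c + 1 + 1) * 2) := by nlinarith
        nlinarith
      linarith
  exact fun k _ hk => key k hk
end

section
/- For every t ≥ 0, a(t) = (1/4)·(1 − 2(1−p_c)/n + (1−p_c)/n²)^t. Moreover: if p_c = (n−1)/(2n−1), then b(t) = (1/4)·(1 + t/(2n−1))·(1 − 1/n)^t for every t ≥ 0; and if p_c ≠ (n−1)/(2n−1), then b(t) = ((n−1)/(4·(1 − 2n + n/(1−p_c))))·(1 − 2(1−p_c)/n + (1−p_c)/n²)^t + ((2 − 3n + n/(1−p_c))/(4·(1 − 2n + n/(1−p_c))))·(1 − 1/n)^t for every t ≥ 0. -/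
/-- Closed forms of the bit-pair probabilities `p_t(0,0)` (here `a`) and
`p_t(0,1)` (here `b`) for the (2:2)-EA with one-bit crossover (probability
`p`) and one-bit mutation on the OneMax problem of size `n`. -/
theorem stmt_9 (n : ℕ) (hn : 1 ≤ n) (p : ℝ) (hp0 : 0 ≤ p) (hp1 : p < 1)
    (a b : ℕ → ℝ)
    (ha0 : a 0 = 1 / 4)
    (ha : ∀ t, a (t + 1) = (p + (1 - p) * (1 - 1 / (n : ℝ)) ^ 2) * a t)
    (hb0 : b 0 = 1 / 4)
    (hb : ∀ t, b (t + 1) = (1 - 1 / (n : ℝ)) * b t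
      + ((1 - p) / (n : ℝ)) * (1 - 1 / (n : ℝ)) * a t) :
    (∀ t : ℕ, a t = (1 / 4) * (1 - 2 * (1 - p) / (n : ℝ) + (1 - p) / (n : ℝ) ^ 2) ^ t) ∧
    (p = ((n : ℝ) - 1) / (2 * (n : ℝ) - 1) →
      ∀ t : ℕ, b t = (1 / 4) * (1 + (t : ℝ) / (2 * (n : ℝ) - 1)) * (1 - 1 / (n : ℝ)) ^ t) ∧
    (p ≠ ((n : ℝ) - 1) / (2 * (n : ℝ) - 1) →
      ∀ t : ℕ, b t =
        (((n : ℝ) - 1) / (4 * (1 - 2 * (n : ℝ) + (n : ℝ) / (1 - p))))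
          * (1 - 2 * (1 - p) / (n : ℝ) + (1 - p) / (n : ℝ) ^ 2) ^ t
        + ((2 - 3 * (n : ℝ) + (n : ℝ) / (1 - p)) / (4 * (1 - 2 * (n : ℝ) + (n : ℝ) / (1 - p))))
          * (1 - 1 / (n : ℝ)) ^ t) := by
  have hn1 : (1 : ℝ) ≤ n := by exact_mod_cast hn
  have hn0 : (n : ℝ) ≠ 0 := by linarith
  have h2n : 2 * (n : ℝ) - 1 ≠ 0 := by linarith
  have hq : 1 - p ≠ 0 := by linarith
  have hA : ∀ t : ℕ, a t =
      (1 / 4) * (1 - 2 * (1 - p) / (n : ℝ) + (1 - p) / (n : ℝ) ^ 2) ^ t := by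
    intro t
    induction t with
    | zero => simp [ha0]
    | succ k ih =>
      rw [ha, ih, pow_succ _ k]
      have : p + (1 - p) * (1 - 1 / (n : ℝ)) ^ 2
          = 1 - 2 * (1 - p) / (n : ℝ) + (1 - p) / (n : ℝ) ^ 2 := by
        field_simp
        ring
      rw [this]
      ring
  refine ⟨hA, ?_, ?_⟩
  · intro hp t
    have hq' : 1 - p = (n : ℝ) / (2 * (n : ℝ) - 1) := by
      rw [hp, eq_div_iff h2n, sub_mul, div_mul_cancel₀ _ h2n]
      ring
    have hqe : (1 - p) / (n : ℝ) = 1 / (2 * (n : ℝ) - 1) := by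
      rw [hq']
      field_simp
    have hr : 1 - 2 * (1 - p) / (n : ℝ) + (1 - p) / (n : ℝ) ^ 2 = 1 - 1 / (n : ℝ) := by
      rw [hq']
      field_simp
      ring
    induction t with
    | zero => simp [hb0]
    | succ k ih =>
      rw [hb, ih, hA, hr, hqe, pow_succ _ k]
      push_cast
      ring
  · intro hp t
    have hD : 1 - 2 * (n : ℝ) + (n : ℝ) / (1 - p) ≠ 0 := by
      intro h
      apply hp
      rw [eq_div_iff h2n]
      field_simp at h
      linarith
    induction t with
    | zero =>
      rw [hb0, pow_zero, pow_zero, mul_one, mul_one, ← add_div, eq_div_iff (by simpa using hD)]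
      ring
    | succ k ih =>
      rw [hb, ih, hA, pow_succ _ k, pow_succ (1 - 1 / (n : ℝ)) k]
      generalize hR : (1 - 2 * (1 - p) / (n : ℝ) + (1 - p) / (n : ℝ) ^ 2) ^ k = R
      generalize (1 - 1 / (n : ℝ)) ^ k = S
      have key : ((1 - p) / (n : ℝ)) * (1 - 1 / (n : ℝ)) * (1 / 4) =
          (((n : ℝ) - 1) / (4 * (1 - 2 * (n : ℝ) + (n : ℝ) / (1 - p)))) *
          ((1 - 2 * (1 - p) / (n : ℝ) + (1 - p) / (n : ℝ) ^ 2) - (1 - 1 / (n : ℝ))) := by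
        have e : (1 - 2 * (1 - p) / (n : ℝ) + (1 - p) / (n : ℝ) ^ 2) - (1 - 1 / (n : ℝ))
            = (1 - 2 * (n : ℝ) + (n : ℝ) / (1 - p)) * ((1 - p) / (n : ℝ) ^ 2) := by
          field_simp
          ring
        rw [e]
        generalize 1 - 2 * (n : ℝ) + (n : ℝ) / (1 - p) = D at hD
        field_simp
      linear_combination R * key
end

section
/- For every t ≥ 0, a(t+1) + b(t+1) ≤ (1 − (1−p_c)/n)·(a(t) + b(t)). Consequently, if c : ℕ → ℝ satisfies c(0) ≤ 1/2 and c(t+1) ≤ (1 − (1−p_c)/n)·c(t) + (1−p_c)/n for all t ≥ 0, then c(t) ≤ 1 − a(t) − b(t) for all t ≥ 0. -/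
/-- One-step contraction of `a(t) + b(t)` (the bit-pair probabilities
`p_t(0,0) + p_t(0,1)`) for the (2:2)-EA with one-bit crossover (probability
`p`) and one-bit mutation on the OneMax problem of size `n`, and the resulting
bound `c(t) ≤ 1 − a(t) − b(t)` for any sequence `c` satisfying the paper's
recursive inequality. -/
theorem stmt_10 (n : ℕ) (hn : 1 ≤ n) (p : ℝ) (hp0 : 0 ≤ p) (hp1 : p < 1)
    (a b : ℕ → ℝ)
    (ha0 : a 0 = 1 / 4)
    (ha : ∀ t, a (t + 1) = (p + (1 - p) * (1 - 1 / (n : ℝ)) ^ 2) * a t)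
    (hb0 : b 0 = 1 / 4)
    (hb : ∀ t, b (t + 1) = (1 - 1 / (n : ℝ)) * b t
      + ((1 - p) / (n : ℝ)) * (1 - 1 / (n : ℝ)) * a t) :
    (∀ t : ℕ, a (t + 1) + b (t + 1) ≤ (1 - (1 - p) / (n : ℝ)) * (a t + b t)) ∧
    (∀ c : ℕ → ℝ, c 0 ≤ 1 / 2 →
      (∀ t : ℕ, c (t + 1) ≤ (1 - (1 - p) / (n : ℝ)) * c t + (1 - p) / (n : ℝ)) →
      ∀ t : ℕ, c t ≤ 1 - a t - b t) := by
  have hn' : (1 : ℝ) ≤ n := by exact_mod_cast hn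
  have hq : (1 - p) / (n : ℝ) = (1 - p) * (1 / (n : ℝ)) := by ring
  have hx0 : 0 ≤ 1 / (n : ℝ) := by positivity
  have hx1 : 1 / (n : ℝ) ≤ 1 := by
    rw [div_le_one (by linarith)]
    exact hn'
  simp only [hq] at hb ⊢
  clear hq
  generalize 1 / (n : ℝ) = x at *
  have h1x : 0 ≤ 1 - x := by linarith
  have h1p : 0 ≤ 1 - p := by linarith
  have hA : ∀ t, 0 ≤ a t := by
    intro t
    induction t with
    | zero => rw [ha0]; norm_num
    | succ k ih => rw [ha]; positivity
  have hB : ∀ t, 0 ≤ b t := by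
    intro t
    induction t with
    | zero => rw [hb0]; norm_num
    | succ k ih =>
      rw [hb]
      have := hA k
      positivity
  have key : ∀ t : ℕ, a (t + 1) + b (t + 1) ≤ (1 - (1 - p) * x) * (a t + b t) := by
    intro t
    rw [ha, hb]
    have h : 0 ≤ p * x * b t := mul_nonneg (mul_nonneg hp0 hx0) (hB t)
    linarith
  refine ⟨key, ?_⟩
  intro c hc0 hc t
  induction t with
  | zero => rw [ha0, hb0]; linarith
  | succ k ih =>
    have hr : 0 ≤ 1 - (1 - p) * x := by nlinarith
    have h1 := mul_le_mul_of_nonneg_left ih hr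
    have h2 := key k
    have h3 := hc k
    linarith
end

section
/- For every integer n ≥ 1, Σ over all pairs (s₁, s₂) of functions Fin n → Bool of the quantity (n − max(LO(s₁), LO(s₂))) equals Σ_{j=1}^{n} (2^n − 2^{j−1})². -/
/-- The number of leading ones of `s : Fin n → Bool`: the largest `m ≤ n`
such that `s i = true` for all `i < m`. -/
noncomputable def LO (n : ℕ) (s : Fin n → Bool) : ℕ :=
  sSup {m | m ≤ n ∧ ∀ i : Fin n, (i : ℕ) < m → s i = true}

theorem le_LO_iff (n : ℕ) (s : Fin n → Bool) (j : ℕ) (hj : j ≤ n) :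
    j ≤ LO n s ↔ ∀ i : Fin n, (i : ℕ) < j → s i = true := by
  have hb : BddAbove {m | m ≤ n ∧ ∀ i : Fin n, (i : ℕ) < m → s i = true} :=
    ⟨n, fun m hm => hm.1⟩
  have hne : {m | m ≤ n ∧ ∀ i : Fin n, (i : ℕ) < m → s i = true}.Nonempty :=
    ⟨0, by simp⟩
  constructor
  · intro h i hi
    exact (Nat.sSup_mem hne hb).2 i (lt_of_lt_of_le hi h)
  · intro h
    exact le_csSup hb ⟨hj, h⟩

theorem card_le_LO (n j : ℕ) (hj : j ≤ n) :
    (Finset.univ.filter (fun s : Fin n → Bool => j ≤ LO n s)).card = 2 ^ (n - j) := by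
  have h1 : (Finset.univ.filter (fun s : Fin n → Bool => j ≤ LO n s)) =
      Fintype.piFinset (fun i : Fin n => if (i : ℕ) < j then ({true} : Finset Bool) else Finset.univ) := by
    ext s
    simp only [Finset.mem_filter, Finset.mem_univ, true_and, Fintype.mem_piFinset, le_LO_iff n s j hj]
    refine forall_congr' fun i => ?_
    by_cases h : (i : ℕ) < j <;> simp [h]
  rw [h1, Fintype.card_piFinset]
  have h2 : ∀ i : Fin n, (if (i : ℕ) < j then ({true} : Finset Bool) else Finset.univ).card
      = (fun k : ℕ => if k < j then 1 else 2) i := by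
    intro i
    by_cases h : (i : ℕ) < j <;> simp [h]
  rw [Finset.prod_congr rfl (fun i _ => h2 i), Fin.prod_univ_eq_prod_range (fun k : ℕ => if k < j then 1 else 2) n]
  obtain ⟨k, rfl⟩ := Nat.exists_eq_add_of_le hj
  rw [Finset.prod_range_add]
  rw [Finset.prod_eq_one (fun x hx => by simp [Finset.mem_range.1 hx])]
  simp

theorem card_LO_lt (n j : ℕ) (hj : j ≤ n) :
    (∑ s : Fin n → Bool, if LO n s < j then 1 else 0) = 2 ^ n - 2 ^ (n - j) := by
  rw [← Finset.card_filter, ← card_le_LO n j hj]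
  have h := Finset.card_filter_add_card_filter_not (s := (Finset.univ : Finset (Fin n → Bool)))
    (fun s => LO n s < j)
  simp only [not_lt, Finset.card_univ, Fintype.card_fun, Fintype.card_bool, Fintype.card_fin] at h
  omega

/-- Summing `n − max(LO(s₁), LO(s₂))` over all pairs of solutions equals
`Σ_{j=1}^{n} (2^n − 2^{j−1})²`. -/
theorem stmt_12 (n : ℕ) (hn : 1 ≤ n) :
    ∑ s₁ : Fin n → Bool, ∑ s₂ : Fin n → Bool, (n - max (LO n s₁) (LO n s₂)) =
      ∑ j ∈ Finset.Icc 1 n, (2 ^ n - 2 ^ (j - 1)) ^ 2 := by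
  have h1 : ∀ a b : ℕ, n - max a b =
      ∑ j ∈ Finset.Icc 1 n, (if a < j then 1 else 0) * (if b < j then 1 else 0) := by
    intro a b
    have : ∀ j, ((if a < j then 1 else 0) * (if b < j then 1 else 0) : ℕ) =
        if max a b < j then 1 else 0 := by
      intro j
      by_cases ha : a < j <;> by_cases hb : b < j <;> simp [ha, hb]
    simp only [this]
    rw [← Finset.card_filter]
    have : (Finset.Icc 1 n).filter (fun j => max a b < j) = Finset.Ioc (max a b) n := by
      ext j
      simp only [Finset.mem_filter, Finset.mem_Icc, Finset.mem_Ioc]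
      omega
    rw [this, Nat.card_Ioc]
  simp only [h1]
  rw [Finset.sum_congr rfl (fun s _ => Finset.sum_comm), Finset.sum_comm]
  simp only [← Finset.mul_sum, ← Finset.sum_mul]
  refine Finset.sum_bij' (fun j _ => n + 1 - j) (fun j _ => n + 1 - j) ?_ ?_ ?_ ?_ ?_
  · intro j hj; simp only [Finset.mem_Icc] at *; omega
  · intro j hj; simp only [Finset.mem_Icc] at *; omega
  · intro j hj; simp only [Finset.mem_Icc] at *; omega
  · intro j hj; simp only [Finset.mem_Icc] at *; omega
  · intro j hj
    simp only [Finset.mem_Icc] at hj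
    rw [card_LO_lt n j hj.2, sq, show n + 1 - j - 1 = n - j by omega]
end

section
/- For every integer n ≥ 1, Σ over all pairs (s₁, s₂) of functions Fin n → Bool of the quantity H_{n − max(‖s₁‖, ‖s₂‖)} equals Σ_{j=1}^{n} (1/j)·(Σ_{k=j}^{n} C(n,k))², where C(n,k) denotes the binomial coefficient. -/
/-- Hamming weight: the number of positions where `s` is `true`. -/
def hammingWeight (n : ℕ) (s : Fin n → Bool) : ℕ :=
  (Finset.univ.filter (fun i : Fin n => s i = true)).card

/-- The `m`-th harmonicNum number. -/
noncomputable def harmonicNum (m : ℕ) : ℝ := ∑ j ∈ Finset.Icc 1 m, (1 : ℝ) / j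

lemma sum_weight_aux (n : ℕ) (f : ℕ → ℝ) :
    ∑ s : Fin n → Bool, f (hammingWeight n s)
      = ∑ k ∈ Finset.range (n + 1), (n.choose k : ℝ) * f k := by
  have h1 : ∑ s : Fin n → Bool, f (hammingWeight n s) = ∑ t : Finset (Fin n), f t.card := by
    refine Finset.sum_bij' (fun s _ => Finset.univ.filter (fun i : Fin n => s i = true))
      (fun t _ => fun i => decide (i ∈ t)) ?_ ?_ ?_ ?_ ?_
    · intros; simp
    · intros; simp
    · intro s _; funext i; simp
    · intro t _; ext i; simp
    · intro s _; rfl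
  rw [h1, ← Finset.powerset_univ, Finset.sum_powerset_apply_card]
  simp

lemma sum_ind_aux (n j : ℕ) :
    ∑ s : Fin n → Bool, (if j + hammingWeight n s ≤ n then (1 : ℝ) else 0)
      = ∑ k ∈ Finset.Icc j n, (n.choose k : ℝ) := by
  rw [sum_weight_aux n (fun w => if j + w ≤ n then (1 : ℝ) else 0),
    ← Finset.sum_range_reflect]
  simp only [mul_ite, mul_one, mul_zero]
  rw [← Finset.sum_filter]
  refine Finset.sum_congr_of_eq_on_inter ?_ ?_ ?_
  · intro k h1 h2
    simp only [Finset.mem_filter, Finset.mem_range, Finset.mem_Icc] at h1 h2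
    omega
  · intro k h1 h2
    simp only [Finset.mem_filter, Finset.mem_range, Finset.mem_Icc] at h1 h2
    omega
  · intro k h1 h2
    simp only [Finset.mem_Icc] at h2
    rw [Nat.add_sub_cancel, Nat.choose_symm h2.2]

lemma harm_aux (n a b : ℕ) :
    harmonicNum (n - max a b) = ∑ j ∈ Finset.Icc 1 n, (1 / (j : ℝ)) *
      ((if j + a ≤ n then (1 : ℝ) else 0) * (if j + b ≤ n then (1 : ℝ) else 0)) := by
  unfold harmonicNum
  have : Finset.Icc 1 (n - max a b)
      = (Finset.Icc 1 n).filter (fun j => j + a ≤ n ∧ j + b ≤ n) := by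
    ext j
    simp only [Finset.mem_filter, Finset.mem_Icc]
    omega
  rw [this, Finset.sum_filter]
  refine Finset.sum_congr rfl fun j _ => ?_
  by_cases h1 : j + a ≤ n <;> by_cases h2 : j + b ≤ n <;> simp [h1, h2]

/-- Summing `H_{n − max(‖s₁‖, ‖s₂‖)}` over all pairs of solutions equals
`Σ_{j=1}^{n} (1/j)·(Σ_{k=j}^{n} C(n,k))²`. -/
theorem stmt_13 (n : ℕ) (hn : 1 ≤ n) :
    ∑ s₁ : Fin n → Bool, ∑ s₂ : Fin n → Bool,
        harmonicNum (n - max (hammingWeight n s₁) (hammingWeight n s₂)) =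
      ∑ j ∈ Finset.Icc 1 n,
        (1 / (j : ℝ)) * (∑ k ∈ Finset.Icc j n, (n.choose k : ℝ)) ^ 2 := by
  simp only [harm_aux]
  simp_rw [← sum_ind_aux, sq, Finset.sum_mul_sum, Finset.mul_sum]
  rw [Finset.sum_comm (s := Finset.Icc 1 n)]
  refine Finset.sum_congr rfl fun s _ => ?_
  rw [Finset.sum_comm]
end

section
/- For every integer n ≥ 1, (1/4)·H_{⌈n/2⌉} ≤ (1/4^n)·Σ_{j=1}^{n} (1/j)·(Σ_{k=j}^{n} C(n,k))² ≤ H_n, where C(n,k) denotes the binomial coefficient and H_m = Σ_{j=1}^{m} 1/j is the m-th harmonic number. -/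
lemma tail_le (n j : ℕ) : (∑ k ∈ Finset.Icc j n, (n.choose k : ℝ)) ≤ 2 ^ n := by
  have h := Nat.sum_range_choose n
  have h2 : (∑ k ∈ Finset.range (n + 1), (n.choose k : ℝ)) = 2 ^ n := by exact_mod_cast h
  rw [← h2]
  apply Finset.sum_le_sum_of_subset_of_nonneg
  · intro k hk
    simp only [Finset.mem_Icc, Finset.mem_range] at *
    omega
  · intros
    positivity

lemma le_tail (n j : ℕ) (hj : 2 * j ≤ n + 1) (hn : 1 ≤ n) :
    (2 : ℝ) ^ n ≤ 2 * ∑ k ∈ Finset.Icc j n, (n.choose k : ℝ) := by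
  have h := Nat.sum_range_choose n
  have h2 : (∑ k ∈ Finset.range (n + 1), (n.choose k : ℝ)) = 2 ^ n := by exact_mod_cast h
  have h3 : Finset.range (n + 1) = Finset.range j ∪ Finset.Icc j n := by
    ext k
    simp only [Finset.mem_union, Finset.mem_Icc, Finset.mem_range]
    omega
  have h4 : ∑ k ∈ Finset.range j, (n.choose k : ℝ) ≤ ∑ k ∈ Finset.Icc j n, (n.choose k : ℝ) := by
    have e : ∑ k ∈ Finset.range j, (n.choose k : ℝ)
        = ∑ k ∈ (Finset.range j).image (fun k => n - k), (n.choose k : ℝ) := by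
      rw [Finset.sum_image]
      · apply Finset.sum_congr rfl
        intro k hk
        rw [Finset.mem_range] at hk
        rw [Nat.choose_symm (by omega)]
      · intro a ha b hb hab
        simp only [Finset.coe_range, Set.mem_Iio] at *
        omega
    rw [e]
    apply Finset.sum_le_sum_of_subset_of_nonneg
    · intro k hk
      simp only [Finset.mem_image, Finset.mem_Icc, Finset.mem_range] at *
      omega
    · intros
      positivity
  have h5 := Finset.sum_union_inter (s₁ := Finset.range j) (s₂ := Finset.Icc j n)
    (f := fun k => (n.choose k : ℝ))
  have h6 : Finset.range j ∩ Finset.Icc j n = ∅ := by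
    ext k
    simp only [Finset.mem_inter, Finset.mem_Icc, Finset.mem_range, Finset.notMem_empty, iff_false]
    omega
  rw [← h3, h6, h2, Finset.sum_empty] at h5
  linarith

/-- Two-sided estimate
`(1/4)·H_{⌈n/2⌉} ≤ (1/4^n)·Σ_{j=1}^{n} (1/j)·(Σ_{k=j}^{n} C(n,k))² ≤ H_n`,
showing the OneMax reference EFHT is `Θ(n log n)`. -/
theorem stmt_15 (n : ℕ) (hn : 1 ≤ n) :
    (1 / 4) * harmonicNum ((n + 1) / 2) ≤
      (1 / 4 ^ n) * ∑ j ∈ Finset.Icc 1 n,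
        (1 / (j : ℝ)) * (∑ k ∈ Finset.Icc j n, (n.choose k : ℝ)) ^ 2 ∧
    (1 / 4 ^ n) * ∑ j ∈ Finset.Icc 1 n,
        (1 / (j : ℝ)) * (∑ k ∈ Finset.Icc j n, (n.choose k : ℝ)) ^ 2 ≤ harmonicNum n := by
  have h4 : (4 : ℝ) ^ n = (2 ^ n) ^ 2 := by
    rw [← pow_mul, mul_comm, pow_mul]; norm_num
  have hp : (0 : ℝ) < 2 ^ n := by positivity
  unfold harmonicNum
  rw [Finset.mul_sum, Finset.mul_sum, h4]
  constructor
  · refine le_trans (Finset.sum_le_sum (g := fun j : ℕ => 1 / ((2 : ℝ) ^ n) ^ 2 *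
        ((1 / (j : ℝ)) * (∑ k ∈ Finset.Icc j n, (n.choose k : ℝ)) ^ 2)) ?_)
      (Finset.sum_le_sum_of_subset_of_nonneg ?_ ?_)
    · intro j hj
      rw [Finset.mem_Icc] at hj
      have h := le_tail n j (by omega) hn
      have hq : (1 : ℝ) / 4 ≤ 1 / ((2 : ℝ) ^ n) ^ 2 * (∑ k ∈ Finset.Icc j n, (n.choose k : ℝ)) ^ 2 := by
        rw [one_div_mul_eq_div, le_div_iff₀ (by positivity)]
        nlinarith
      have := mul_le_mul_of_nonneg_right hq (show (0 : ℝ) ≤ 1 / (j : ℝ) by positivity)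
      linarith
    · apply Finset.Icc_subset_Icc_right
      omega
    · intros
      positivity
  · apply Finset.sum_le_sum
    intro j hj
    have h := tail_le n j
    have h0 : 0 ≤ ∑ k ∈ Finset.Icc j n, (n.choose k : ℝ) := by positivity
    have hq : 1 / ((2 : ℝ) ^ n) ^ 2 * (∑ k ∈ Finset.Icc j n, (n.choose k : ℝ)) ^ 2 ≤ 1 := by
      rw [one_div_mul_eq_div, div_le_one (by positivity)]
      gcongr
    have := mul_le_mul_of_nonneg_right hq (show (0 : ℝ) ≤ 1 / (j : ℝ) by positivity)
    linarith
end

section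
/- For all integers i ≥ 1 and δ ≥ 1 with i + δ ≤ n, E(i, i+δ) − E(i, i) ≥ (n/4)·(1 − 1/2^{δ}). -/
/-- Telescoped bound `E(i, i+δ) − E(i, i) ≥ (n/4)·(1 − 1/2^δ)` for the CFHT of
the (2:2)-EA with one-bit mutation only on the LeadingOnes problem of size `n`. -/
theorem stmt_16 (n : ℕ) (hn : 2 ≤ n) (E : ℕ → ℕ → ℝ)
    (hE1 : ∀ i, E i 0 = 0) (hE2 : ∀ j, E 0 j = 0)
    (hrec : ∀ i j : ℕ, 1 ≤ i → i ≤ n → 1 ≤ j → j ≤ n →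
      E i j = (n : ℝ) ^ 2 / (2 * n - 1)
        + ((n - 1) / (2 * (n : ℝ) - 1)) * E (i - 1) j
        + ((n - 1) / (2 * (n : ℝ) - 1)) * E i (j - 1)
        + (1 / (2 * (n : ℝ) - 1)) * E (i - 1) (j - 1)) :
    ∀ i δ : ℕ, 1 ≤ i → 1 ≤ δ → i + δ ≤ n →
      E i (i + δ) - E i i ≥ ((n : ℝ) / 4) * (1 - 1 / 2 ^ δ) := by
  have hN : (2:ℝ) ≤ n := by exact_mod_cast hn
  set N : ℝ := (n : ℝ) with hNdef
  have hM : (0:ℝ) < 2 * N - 1 := by linarith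
  have R : ∀ i j : ℕ, i < n → j < n →
      (2 * N - 1) * E (i+1) (j+1) = N^2 + (N-1) * E i (j+1) + (N-1) * E (i+1) j + E i j := by
    intro i j hi hj
    have h := hrec (i+1) (j+1) (by omega) (by omega) (by omega) (by omega)
    simp only [Nat.add_sub_cancel] at h
    rw [h]
    field_simp
  clear hrec
  have symm : ∀ s i j : ℕ, i + j = s → i ≤ n → j ≤ n → E i j = E j i := by
    intro s
    induction s using Nat.strong_induction_on with
    | _ s ih =>
      intro i j hs hi hj
      rcases i with _ | i
      · rw [hE1, hE2]
      rcases j with _ | j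
      · rw [hE1, hE2]
      have h1 := R i j (by omega) (by omega)
      have h2 := R j i (by omega) (by omega)
      have a1 := ih (i + (j+1)) (by omega) i (j+1) rfl (by omega) (by omega)
      have a2 := ih (i + 1 + j) (by omega) (i+1) j rfl (by omega) (by omega)
      have a3 := ih (i + j) (by omega) i j rfl (by omega) (by omega)
      rw [a1, a2, a3] at h1
      apply mul_left_cancel₀ hM.ne'
      linarith
  have DR : ∀ i j : ℕ, i < n → j + 1 < n →
      (2 * N - 1) * (E (i+1) (j+2) - E (i+1) (j+1)) = (N-1) * (E i (j+2) - E i (j+1))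
        + (N-1) * (E (i+1) (j+1) - E (i+1) j) + (E i (j+1) - E i j) := by
    intro i j hi hj
    have h1 := R i (j+1) hi hj
    have h2 := R i j hi (by omega)
    simp only [add_assoc, Nat.reduceAdd] at h1 h2 ⊢
    linarith
  have U : ∀ i : ℕ, i ≤ n → ∀ j : ℕ, j < n → E i (j+1) - E i j ≤ N := by
    intro i
    induction i with
    | zero => intro _ j _; rw [hE2, hE2]; linarith
    | succ i ih =>
      intro hi j
      induction j with
      | zero =>
        intro hj
        have h := R i 0 (by omega) (by omega)
        have h3 := ih (by omega) 0 (by omega)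
        simp only [hE1] at h h3 ⊢
        refine le_of_mul_le_mul_left ?_ hM
        nlinarith
      | succ j ihj =>
        intro hj
        have h := DR i j (by omega) (by omega)
        have h1 := ih (by omega) (j+1) (by omega)
        have h2 := ih (by omega) j (by omega)
        have h3 := ihj (by omega)
        refine le_of_mul_le_mul_left ?_ hM
        simp only [add_assoc, Nat.reduceAdd] at h h1 h2 h3 ⊢
        nlinarith
  have B : ∀ k : ℕ, k < n → N * (2 * N - 1 - k) ≤ 2 * (2 * N - 1) * (2^k * (E 1 (k+1) - E 1 k)) := by
    intro k
    induction k with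
    | zero =>
      intro hk
      have h := R 0 0 (by omega) (by omega)
      simp only [hE1, hE2, zero_add] at h ⊢
      push_cast
      nlinarith
    | succ k ih =>
      intro hk
      have h := DR 0 k (by omega) (by omega)
      have h1 := ih (by omega)
      simp only [hE2, zero_add, add_assoc, Nat.reduceAdd] at h h1 ⊢
      set X := E 1 (k+1) - E 1 k
      set Y := E 1 (k+2) - E 1 (k+1)
      have hk0 : (0:ℝ) ≤ k := Nat.cast_nonneg k
      have e : 2 * (2 * N - 1) * (2^(k+1) * Y) = 4 * (N-1) * (2^k * X) := by
        have : (2 * N - 1) * Y = (N-1) * X := by linarith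
        rw [pow_succ]
        linear_combination 4 * 2^k * this
      rw [e]
      push_cast
      refine le_of_mul_le_mul_left ?_ hM
      have h2 := mul_le_mul_of_nonneg_left h1 (by linarith : (0:ℝ) ≤ 2 * (N-1))
      have h3 : 0 ≤ N * k := by positivity
      nlinarith
  have L : ∀ i : ℕ, ∀ k : ℕ, i + 1 + k ≤ n →
      N / 4 ≤ 2^k * (E (i+1) (i+k+1) - E (i+1) (i+k)) := by
    intro i
    induction i with
    | zero =>
      intro k hk
      have h := B k (by omega)
      have hk' : (k:ℝ) + 1 ≤ N := by rw [hNdef]; exact_mod_cast (by omega : k + 1 ≤ n)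
      simp only [zero_add]
      refine le_of_mul_le_mul_left ?_ hM
      nlinarith
    | succ i ih =>
      intro k
      induction k with
      | zero =>
        intro hk
        have h := R (i+1) (i+1) (by omega) (by omega)
        have s := symm _ (i+1+1) (i+1) rfl (by omega) (by omega)
        have u := U (i+1) (by omega) (i+1) (by omega)
        simp only [add_zero, pow_zero, one_mul]
        rw [s] at h ⊢
        refine le_of_mul_le_mul_left ?_ hM
        nlinarith
      | succ k ihk =>
        intro hk
        have h := DR (i+1) (i+1+k) (by omega) (by omega)
        have a1 := ihk (by omega)
        have a2 := ih (k+2) (by omega)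
        have a3 := ih (k+1) (by omega)
        rw [show i + (k+2) + 1 = i+1+k+2 by ring, show i + (k+2) = i+1+k+1 by ring] at a2
        rw [show i + (k+1) + 1 = i+1+k+1 by ring, show i + (k+1) = i+1+k by ring] at a3
        rw [show i + 1 + (k+1) + 1 = i+1+k+2 by ring, show i + 1 + (k+1) = i+1+k+1 by ring]
        generalize E (i+1+1) (i+1+k+2) - E (i+1+1) (i+1+k+1) = W at *
        generalize E (i+1) (i+1+k+2) - E (i+1) (i+1+k+1) = X at *
        generalize E (i+1+1) (i+1+k+1) - E (i+1+1) (i+1+k) = Y at *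
        generalize E (i+1) (i+1+k+1) - E (i+1) (i+1+k) = Z at *
        refine le_of_mul_le_mul_left ?_ hM
        have e : (2*N-1) * (2^(k+1) * W) = (N-1) * ((2^(k+2) * X)/2) + (N-1) * (2 * (2^k * Y))
            + 2^(k+1) * Z := by
          rw [pow_succ, pow_succ 2 (k+1), pow_succ]
          linear_combination 2^k * 2 * h
        rw [e]
        have b1 := mul_le_mul_of_nonneg_left a1 (by linarith : (0:ℝ) ≤ N - 1)
        have b2 := mul_le_mul_of_nonneg_left a2 (by linarith : (0:ℝ) ≤ N - 1)
        nlinarith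
  intro i δ hi _ hd
  clear * - L hi hd
  obtain ⟨i, rfl⟩ : ∃ m, i = m + 1 := ⟨i - 1, by omega⟩
  induction δ with
  | zero => simp
  | succ d ih =>
    have h := ih (by omega)
    have l := L i (d+1) (by omega)
    rw [show i + (d+1) + 1 = i+1+(d+1) by ring, show i + (d+1) = i+1+d by ring] at l
    have hp : (0:ℝ) < 2^(d+1) := by positivity
    have l2 : N / 4 / 2^(d+1) ≤ E (i+1) (i+1+(d+1)) - E (i+1) (i+1+d) := by
      rw [div_le_iff₀ hp]; linarith
    have e : N/4 * (1 - 1/2^(d+1)) = N/4 * (1 - 1/2^d) + N / 4 / 2^(d+1) := by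
      rw [pow_succ]; field_simp; ring
    rw [e]
    linarith
end

section
/- E(1,1) = n²/(2n−1); for all integers 1 ≤ i ≤ n, E(i,1) ≥ n²/(2n−1); and for all integers 1 ≤ j ≤ n, E(1,j) − E(1,j−1) ≤ n²/(2n−1). -/
/-- Facts about the CFHT of the (2:2)-EA with one-bit mutation only on the
LeadingOnes problem of size `n`: `E(1,1) = n²/(2n−1)`, `E(i,1) ≥ n²/(2n−1)`
and `E(1,j) − E(1,j−1) ≤ n²/(2n−1)`. -/
theorem stmt_17 (n : ℕ) (hn : 2 ≤ n) (E : ℕ → ℕ → ℝ)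
    (hE1 : ∀ i, E i 0 = 0) (hE2 : ∀ j, E 0 j = 0)
    (hrec : ∀ i j : ℕ, 1 ≤ i → i ≤ n → 1 ≤ j → j ≤ n →
      E i j = (n : ℝ) ^ 2 / (2 * n - 1)
        + ((n - 1) / (2 * (n : ℝ) - 1)) * E (i - 1) j
        + ((n - 1) / (2 * (n : ℝ) - 1)) * E i (j - 1)
        + (1 / (2 * (n : ℝ) - 1)) * E (i - 1) (j - 1)) :
    E 1 1 = (n : ℝ) ^ 2 / (2 * (n : ℝ) - 1) ∧
    (∀ i : ℕ, 1 ≤ i → i ≤ n → E i 1 ≥ (n : ℝ) ^ 2 / (2 * (n : ℝ) - 1)) ∧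
    (∀ j : ℕ, 1 ≤ j → j ≤ n →
      E 1 j - E 1 (j - 1) ≤ (n : ℝ) ^ 2 / (2 * (n : ℝ) - 1)) := by
  have hn' : (2 : ℝ) ≤ n := by exact_mod_cast hn
  have hd : (0 : ℝ) < 2 * (n : ℝ) - 1 := by linarith
  have ha0 : (0 : ℝ) ≤ (n - 1) / (2 * (n : ℝ) - 1) := div_nonneg (by linarith) hd.le
  have ha1 : ((n : ℝ) - 1) / (2 * (n : ℝ) - 1) ≤ 1 := by
    rw [div_le_one hd]; linarith
  have hc : (0 : ℝ) ≤ (n : ℝ) ^ 2 / (2 * (n : ℝ) - 1) := div_nonneg (by positivity) hd.le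
  generalize (n : ℝ) ^ 2 / (2 * (n : ℝ) - 1) = c at *
  generalize ((n : ℝ) - 1) / (2 * (n : ℝ) - 1) = a at *
  have r1 : ∀ k : ℕ, k + 1 ≤ n → E 1 (k + 1) = c + a * E 1 k := by
    intro k hk
    have h := hrec 1 (k + 1) le_rfl (by omega) (by omega) hk
    simpa [hE1, hE2] using h
  have r2 : ∀ k : ℕ, k + 1 ≤ n → E (k + 1) 1 = c + a * E k 1 := by
    intro k hk
    have h := hrec (k + 1) 1 (by omega) hk le_rfl (by omega)
    simpa [hE1, hE2] using h
  have p1 : ∀ k : ℕ, k ≤ n → 0 ≤ E 1 k := by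
    intro k
    induction k with
    | zero => intro _; rw [hE1]
    | succ k ih =>
      intro hk
      rw [r1 k hk]
      exact add_nonneg hc (mul_nonneg ha0 (ih (by omega)))
  have p2 : ∀ k : ℕ, k ≤ n → 0 ≤ E k 1 := by
    intro k
    induction k with
    | zero => intro _; rw [hE2]
    | succ k ih =>
      intro hk
      rw [r2 k hk]
      exact add_nonneg hc (mul_nonneg ha0 (ih (by omega)))
  refine ⟨?_, ?_, ?_⟩
  · have h := r1 0 (by omega)
    simpa [hE1] using h
  · intro i hi hin
    obtain ⟨k, rfl⟩ := Nat.exists_eq_add_of_le' hi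
    rw [r2 k hin]
    have := mul_nonneg ha0 (p2 k (by omega))
    linarith
  · intro j hj hjn
    obtain ⟨k, rfl⟩ := Nat.exists_eq_add_of_le' hj
    rw [Nat.add_sub_cancel, r1 k hjn]
    have := mul_le_of_le_one_left (p1 k (by omega)) ha1
    linarith
end
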